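/- Define polynomials P_h(q,z) by P_0 = 0, P_1 = 1, and for h ≥ 2, P_h(q,z) = (1 - q^{2h-3}(q^{2h} + q^{2h-2} - 1) z)·P_{h-1}(q,z) - q^{6h-10}(q^{2h-2} - 1) z²·P_{h-2}(q,z). Then for all h ≥ 1, P_h(q,z) = ∑_{n=0}^{h-1} ( ∑_{i=0}^{n} [h,i]_{q²}·q^{(2h-1)i}·(-1)^i·q^{(n-i)²} )·z^n. -/

import Mathlib

/-- The q-Pochhammer symbol `(a; q)_n = ∏_{j=0}^{n-1} (1 - a q^j)`. -/
noncomputable def qPoch {K : Type*} [Field K] (q a : K) (n : ℕ) : K :=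
  ∏ j ∈ Finset.range n, (1 - a * q ^ j)

/-- The Gaussian (q-binomial) coefficient `[n, m]_q`. -/
noncomputable def qBinom {K : Type*} [Field K] (q : K) (n m : ℕ) : K :=
  qPoch q q n / (qPoch q q m * qPoch q q (n - m))

/-- The numerator convergents `P_h(q, z)` of the square series J-fraction. -/
noncomputable def Pconv {K : Type*} [Field K] (q z : K) : ℕ → K
  | 0 => 0
  | 1 => 1
  | (h + 2) =>
      (1 - q ^ (2 * (h + 2) - 3) * (q ^ (2 * (h + 2)) + q ^ (2 * (h + 2) - 2) - 1) * z) *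
          Pconv q z (h + 1)
        - q ^ (6 * (h + 2) - 10) * (q ^ (2 * (h + 2) - 2) - 1) * z ^ 2 * Pconv q z h

/-- Gaussian binomials by the Pascal recurrence. -/
noncomputable def gB {K : Type*} [Field K] (Q : K) : ℕ → ℕ → K
  | _, 0 => 1
  | 0, (_ + 1) => 0
  | (n + 1), (i + 1) => gB Q n i + Q ^ (i + 1) * gB Q n (i + 1)

lemma gB_zero {K : Type*} [Field K] (Q : K) (n : ℕ) : gB Q n 0 = 1 := by
  cases n <;> rfl

lemma gB_zero_succ {K : Type*} [Field K] (Q : K) (i : ℕ) : gB Q 0 (i + 1) = 0 := rfl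

lemma gB_succ {K : Type*} [Field K] (Q : K) (n i : ℕ) :
    gB Q (n + 1) (i + 1) = gB Q n i + Q ^ (i + 1) * gB Q n (i + 1) := rfl

lemma gB_gt {K : Type*} [Field K] (Q : K) (n : ℕ) : ∀ i, n < i → gB Q n i = 0 := by
  induction n with
  | zero => intro i hi; obtain ⟨j, rfl⟩ := Nat.exists_eq_succ_of_ne_zero hi.ne'; rfl
  | succ n ih =>
    intro i hi
    obtain ⟨j, rfl⟩ : ∃ j, i = j + 1 := ⟨i - 1, by omega⟩
    rw [gB_succ, ih j (by omega), ih (j + 1) (by omega)]; ring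

lemma gB_ratio {K : Type*} [Field K] (Q : K) (n : ℕ) : ∀ i,
    Q ^ i * (1 - Q ^ (i + 1)) * gB Q n (i + 1) = (Q ^ i - Q ^ n) * gB Q n i := by
  induction n with
  | zero =>
    intro i
    cases i with
    | zero => simp [gB_zero_succ]
    | succ j => simp [gB_zero_succ]
  | succ n ih =>
    intro i
    cases i with
    | zero =>
      have h0 := ih 0
      simp only [gB_zero, gB_succ] at *
      linear_combination Q * h0
    | succ j =>
      have h0 := ih (j + 1)
      have h1 := ih j
      simp only [gB_succ] at *
      linear_combination Q ^ (j + 2) * h0 + Q * h1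

lemma gB_absorb {K : Type*} [Field K] (Q : K) (hQ : Q ≠ 0) (n i : ℕ) :
    (1 - Q ^ (i + 1)) * gB Q (n + 1) (i + 1) = (1 - Q ^ (n + 1)) * gB Q n i := by
  apply mul_left_cancel₀ (pow_ne_zero i hQ)
  rw [gB_succ]
  linear_combination Q ^ (i + 1) * gB_ratio Q n i

lemma gB_dual {K : Type*} [Field K] (Q : K) (n i : ℕ) :
    Q ^ i * gB Q (n + 1) (i + 1) = Q ^ i * gB Q n (i + 1) + Q ^ n * gB Q n i := by
  rw [gB_succ]
  linear_combination - gB_ratio Q n i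

lemma gB_rec {K : Type*} [Field K] (Q : K) (hQ : Q ≠ 0) (h i : ℕ) :
    Q ^ i * Q ^ (i + 2) * gB Q (h + 2) (i + 2) = Q ^ i * gB Q (h + 1) (i + 2)
      + Q ^ i * (Q ^ (h + 2) + Q ^ (h + 1) - 1) * gB Q (h + 1) (i + 1)
      - Q ^ h * (Q ^ (h + 1) - 1) * gB Q h i := by
  have h1 := gB_absorb Q hQ h i
  have h2 := gB_absorb Q hQ (h + 1) (i + 1)
  have h3 := gB_dual Q (h + 1) (i + 1)
  apply mul_left_cancel₀ hQ
  linear_combination h3 - Q ^ (i + 1) * h2 + Q ^ (h + 1) * h1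

lemma gB_poch {K : Type*} [Field K] (Q : K) (hQ : Q ≠ 0) (i d : ℕ) :
    gB Q (i + d) i * (qPoch Q Q i * qPoch Q Q d) = qPoch Q Q (i + d) := by
  induction i with
  | zero => simp [gB_zero, qPoch]
  | succ i ih =>
    have e : i + 1 + d = (i + d) + 1 := by omega
    have hp : ∀ n, qPoch Q Q (n + 1) = qPoch Q Q n * (1 - Q ^ (n + 1)) := by
      intro n; simp only [qPoch, Finset.prod_range_succ]; ring
    rw [e, hp, hp, ← ih]
    linear_combination (qPoch Q Q i * qPoch Q Q d) * gB_absorb Q hQ (i + d) i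

lemma qBinom_eq_gB {K : Type*} [Field K] (Q : K) (hQ : Q ≠ 0)
    (hr : ∀ k : ℕ, 1 ≤ k → Q ^ k ≠ 1) (n i : ℕ) (hi : i ≤ n) :
    qBinom Q n i = gB Q n i := by
  obtain ⟨d, rfl⟩ := Nat.exists_eq_add_of_le hi
  have hne : ∀ n, qPoch Q Q n ≠ 0 := by
    intro n
    refine Finset.prod_ne_zero_iff.2 fun j _ => ?_
    rw [← pow_succ']
    exact sub_ne_zero.2 (hr (j + 1) (by omega)).symm
  rw [qBinom, Nat.add_sub_cancel_left, div_eq_iff (mul_ne_zero (hne _) (hne _)), gB_poch Q hQ]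

/-- Coefficients of the polynomial factor. -/
noncomputable def bC {K : Type*} [Field K] (q : K) (h i : ℕ) : K :=
  gB (q ^ 2) h i * q ^ ((2 * (h : ℤ) - 1) * (i : ℤ)) * (-1) ^ i

lemma bC_zero {K : Type*} [Field K] (q : K) (h : ℕ) : bC q h 0 = 1 := by
  simp [bC, gB_zero]

lemma bC_one {K : Type*} [Field K] (q : K) (hq : q ≠ 0) (h : ℕ) :
    bC q (h + 2) 1 = bC q (h + 1) 1
      - q ^ (2 * h + 1) * (q ^ (2 * h + 4) + q ^ (2 * h + 2) - 1) * bC q (h + 1) 0 := by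
  have e1 : q ^ ((2 * ((h + 2 : ℕ) : ℤ) - 1) * ((1 : ℕ) : ℤ)) = q ^ (2 * h + 3) := by
    rw [← zpow_natCast]; congr 1; push_cast; ring
  have e2 : q ^ ((2 * ((h + 1 : ℕ) : ℤ) - 1) * ((1 : ℕ) : ℤ)) = q ^ (2 * h + 1) := by
    rw [← zpow_natCast]; congr 1; push_cast; ring
  have h2 := gB_absorb (q ^ 2) (pow_ne_zero 2 hq) (h + 1) 0
  have h3 := gB_dual (q ^ 2) (h + 1) 0
  rw [bC_zero]
  unfold bC
  rw [e1, e2]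
  simp only [gB_zero, zero_add] at h2 h3
  linear_combination q ^ (2 * h + 1) * (h2 - h3)

lemma bC_rec {K : Type*} [Field K] (q : K) (hq : q ≠ 0) (h i : ℕ) :
    bC q (h + 2) (i + 2) = bC q (h + 1) (i + 2)
      - q ^ (2 * h + 1) * (q ^ (2 * h + 4) + q ^ (2 * h + 2) - 1) * bC q (h + 1) (i + 1)
      - q ^ (6 * h + 2) * (q ^ (2 * h + 2) - 1) * bC q h i := by
  have e1 : q ^ ((2 * ((h + 2 : ℕ) : ℤ) - 1) * ((i + 2 : ℕ) : ℤ))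
      = q ^ ((2 * (h : ℤ) - 1) * (i : ℤ)) * q ^ (4 * i + 4 * h + 6) := by
    rw [← zpow_natCast, ← zpow_add₀ hq]; congr 1; push_cast; ring
  have e2 : q ^ ((2 * ((h + 1 : ℕ) : ℤ) - 1) * ((i + 2 : ℕ) : ℤ))
      = q ^ ((2 * (h : ℤ) - 1) * (i : ℤ)) * q ^ (2 * i + 4 * h + 2) := by
    rw [← zpow_natCast, ← zpow_add₀ hq]; congr 1; push_cast; ring
  have e3 : q ^ ((2 * ((h + 1 : ℕ) : ℤ) - 1) * ((i + 1 : ℕ) : ℤ))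
      = q ^ ((2 * (h : ℤ) - 1) * (i : ℤ)) * q ^ (2 * i + 2 * h + 1) := by
    rw [← zpow_natCast, ← zpow_add₀ hq]; congr 1; push_cast; ring
  have h1 := gB_rec (q ^ 2) (pow_ne_zero 2 hq) h i
  unfold bC
  rw [e1, e2, e3]
  generalize q ^ ((2 * (h : ℤ) - 1) * (i : ℤ)) = W
  linear_combination W * (-1) ^ i * q ^ (4 * h + 2) * h1

/-- Coefficients of the product with the square series. -/
noncomputable def aC {K : Type*} [Field K] (q : K) (h n : ℕ) : K :=
  ∑ i ∈ Finset.range (n + 1), bC q h i * q ^ ((n - i) ^ 2)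

lemma aC_zero {K : Type*} [Field K] (q : K) (h : ℕ) : aC q h 0 = 1 := by
  simp [aC, bC_zero]

lemma aC_one {K : Type*} [Field K] (q : K) (hq : q ≠ 0) (h : ℕ) :
    aC q (h + 2) 1 = aC q (h + 1) 1
      - q ^ (2 * h + 1) * (q ^ (2 * h + 4) + q ^ (2 * h + 2) - 1) * aC q (h + 1) 0 := by
  simp [aC, Finset.sum_range_succ, bC_one q hq h, bC_zero]
  ring

lemma aC_rec {K : Type*} [Field K] (q : K) (hq : q ≠ 0) (h n : ℕ) :
    aC q (h + 2) (n + 2) = aC q (h + 1) (n + 2)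
      - q ^ (2 * h + 1) * (q ^ (2 * h + 4) + q ^ (2 * h + 2) - 1) * aC q (h + 1) (n + 1)
      - q ^ (6 * h + 2) * (q ^ (2 * h + 2) - 1) * aC q h n := by
  have two : ∀ H, aC q H (n + 2) = ∑ i ∈ Finset.range (n + 1), bC q H (i + 2) * q ^ ((n - i) ^ 2)
      + bC q H 1 * q ^ ((n + 1) ^ 2) + q ^ ((n + 2) ^ 2) := by
    intro H
    rw [aC, Finset.sum_range_succ', Finset.sum_range_succ', bC_zero]
    simp
  have one : ∀ H, aC q H (n + 1) = ∑ i ∈ Finset.range (n + 1), bC q H (i + 1) * q ^ ((n - i) ^ 2)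
      + q ^ ((n + 1) ^ 2) := by
    intro H
    rw [aC, Finset.sum_range_succ', bC_zero]
    simp
  rw [two, two, one, aC, bC_one q hq h, bC_zero]
  simp only [bC_rec q hq h, sub_mul, Finset.sum_sub_distrib, mul_assoc, ← Finset.mul_sum]
  ring

lemma gB_alt {K : Type*} [Field K] (q : K) (h m : ℕ) :
    ∑ i ∈ Finset.range (m + 1), (-1) ^ i * gB (q ^ 2) (h + 1) i * q ^ (i * (i - 1))
      = (-1) ^ m * q ^ ((m + 1) * m) * gB (q ^ 2) h m := by
  induction m with
  | zero => simp [gB_zero]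
  | succ m ih =>
    rw [Finset.sum_range_succ, ih, gB_succ, Nat.add_sub_cancel]
    ring

lemma aC_diag {K : Type*} [Field K] (q : K) (hq : q ≠ 0) (h : ℕ) :
    aC q (h + 1) (h + 1) = 0 := by
  have key : aC q (h + 1) (h + 1) = q ^ ((h + 1) ^ 2) *
      ∑ i ∈ Finset.range (h + 1 + 1),
        (-1) ^ i * gB (q ^ 2) (h + 1) i * q ^ (i * (i - 1)) := by
    rw [aC, Finset.mul_sum]
    refine Finset.sum_congr rfl fun i hi => ?_
    have hi' : i ≤ h + 1 := by simpa [Nat.lt_succ_iff] using hi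
    have e : q ^ ((2 * ((h + 1 : ℕ) : ℤ) - 1) * (i : ℤ)) * q ^ ((h + 1 - i) ^ 2)
        = q ^ ((h + 1) ^ 2) * q ^ (i * (i - 1)) := by
      rw [← zpow_natCast, ← zpow_natCast, ← zpow_natCast, ← zpow_add₀ hq, ← zpow_add₀ hq]
      congr 1
      rcases Nat.eq_zero_or_pos i with rfl | hp
      · simp
      · push_cast [Nat.cast_sub hi', Nat.cast_sub hp]
        ring
    unfold bC
    linear_combination gB (q ^ 2) (h + 1) i * (-1) ^ i * e
  rw [key, gB_alt, gB_gt _ h (h + 1) (by omega)]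
  ring

lemma Pconv_eq {K : Type*} [Field K] (q z : K) (hq : q ≠ 0) (h : ℕ) :
    Pconv q z h = ∑ n ∈ Finset.range h, aC q h n * z ^ n ∧
    Pconv q z (h + 1) = ∑ n ∈ Finset.range (h + 1), aC q (h + 1) n * z ^ n := by
  induction h with
  | zero => simp [Pconv, aC_zero]
  | succ h ih =>
    refine ⟨ih.2, ?_⟩
    have e1 : 2 * (h + 2) - 3 = 2 * h + 1 := by omega
    have e2 : 2 * (h + 2) - 2 = 2 * h + 2 := by omega
    have e3 : 6 * (h + 2) - 10 = 6 * h + 2 := by omega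
    have e4 : 2 * (h + 2) = 2 * h + 4 := by omega
    have s1 : ∑ n ∈ Finset.range (h + 1), aC q (h + 1) n * z ^ n
        = ∑ n ∈ Finset.range h, aC q (h + 1) (n + 2) * z ^ n * z ^ 2
          + aC q (h + 1) 1 * z + 1 := by
      have : ∑ n ∈ Finset.range (h + 2), aC q (h + 1) n * z ^ n
          = ∑ n ∈ Finset.range (h + 1), aC q (h + 1) n * z ^ n := by
        rw [Finset.sum_range_succ, aC_diag q hq]; simp
      rw [← this, Finset.sum_range_succ', Finset.sum_range_succ', aC_zero]
      simp [pow_succ, mul_assoc]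
    have s2 : ∑ n ∈ Finset.range (h + 1), aC q (h + 1) n * z ^ n
        = ∑ n ∈ Finset.range h, aC q (h + 1) (n + 1) * z ^ n * z + 1 := by
      rw [Finset.sum_range_succ', aC_zero]
      simp [pow_succ, mul_assoc]
    have s3 : ∑ n ∈ Finset.range (h + 2), aC q (h + 2) n * z ^ n
        = ∑ n ∈ Finset.range h, aC q (h + 2) (n + 2) * z ^ n * z ^ 2
          + aC q (h + 2) 1 * z + 1 := by
      rw [Finset.sum_range_succ', Finset.sum_range_succ', aC_zero]
      simp [pow_succ, mul_assoc]
    change Pconv q z (h + 2) = ∑ n ∈ Finset.range (h + 2), aC q (h + 2) n * z ^ n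
    rw [s3, Pconv, e1, e2, e3, e4, ih.1, ih.2, aC_one q hq, aC_zero]
    rw [sub_mul, one_mul]
    nth_rewrite 1 [s1]
    rw [s2]
    simp only [aC_rec q hq h, sub_mul, Finset.sum_sub_distrib, mul_assoc, ← Finset.mul_sum]
    simp only [← mul_assoc, ← Finset.sum_mul]
    ring

theorem stmt5 {K : Type*} [Field K] (q z : K) (hq : q ≠ 0)
    (hroot : ∀ k : ℕ, 1 ≤ k → q ^ k ≠ 1) (h : ℕ) (hh : 1 ≤ h) :
    Pconv q z h =
      ∑ n ∈ Finset.range h,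
        (∑ i ∈ Finset.range (n + 1),
          qBinom (q ^ 2) h i * q ^ ((2 * (h : ℤ) - 1) * (i : ℤ)) * (-1) ^ i *
            q ^ ((n - i) ^ 2)) * z ^ n := by
  rw [(Pconv_eq q z hq h).1]
  refine Finset.sum_congr rfl fun n hn => ?_
  congr 1
  refine Finset.sum_congr rfl fun i hi => ?_
  rw [Finset.mem_range] at hn hi
  rw [qBinom_eq_gB (q ^ 2) (pow_ne_zero 2 hq) _ h i (by omega)]
  · rfl
  · intro k hk
    rw [← pow_mul]
    exact hroot _ (by omega)
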